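/- Let X be a compact subset of a Banach space B with thickness exponent τ(X) < 1. Then for every α > (1 + τ(X))/(1 − τ(X)) there exist a separable Hilbert space H, a bounded linear map Φ : B → H, and C_α > 0 such that C_α^{-1}‖x − y‖^α ≤ ‖Φ(x) − Φ(y)‖ ≤ C_α‖x − y‖ for all x, y ∈ X. -/

import Mathlib

open Filter Metric Set Pointwise Topology

/-- `coverNum X ε` : minimal number of balls of radius `ε` with centres in `X` covering `X`. -/
noncomputable def coverNum {E : Type*} [SeminormedAddCommGroup E] (X : Set E) (ε : ℝ) : ℕ∞ :=
  sInf {n : ℕ∞ | ∃ F : Finset E, ↑F ⊆ X ∧ (X ⊆ ⋃ c ∈ F, Metric.ball c ε) ∧ n = F.card}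

/-- extended logarithm of an extended natural number. -/
noncomputable def elog (n : ℕ∞) : EReal :=
  if n = ⊤ then ⊤ else ((Real.log n.toNat : ℝ) : EReal)

/-- The upper box-counting dimension `d_B(X) = limsup_{ε → 0⁺} log N(X,ε) / (-log ε)`. -/
noncomputable def dimBox {E : Type*} [SeminormedAddCommGroup E] (X : Set E) : EReal :=
  Filter.limsup (fun ε : ℝ => elog (coverNum X ε) / ((-Real.log ε : ℝ) : EReal)) (𝓝[>] 0)

/-- `thickNum X ε` : smallest dimension of a finite-dimensional subspace `V` with
`dist(x, V) ≤ ε` for all `x ∈ X` (`⊤` if none exists). -/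
noncomputable def thickNum {E : Type*} [NormedAddCommGroup E] [NormedSpace ℝ E]
    (X : Set E) (ε : ℝ) : ℕ∞ :=
  sInf {n : ℕ∞ | ∃ V : Submodule ℝ E, FiniteDimensional ℝ V ∧ n = Module.finrank ℝ V ∧
    ∀ x ∈ X, Metric.infDist x (V : Set E) ≤ ε}

/-- The thickness exponent `τ(X) = limsup_{ε → 0⁺} log d(X,ε) / (-log ε)`. -/
noncomputable def thickness {E : Type*} [NormedAddCommGroup E] [NormedSpace ℝ E]
    (X : Set E) : EReal :=
  Filter.limsup (fun ε : ℝ => elog (thickNum X ε) / ((-Real.log ε : ℝ) : EReal)) (𝓝[>] 0)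

/-- `dualThickNum X θ ε` : minimal dimension of a subspace `U ⊆ E*` such that for all
`x, y ∈ X` with `‖x - y‖ ≥ ε` some `φ ∈ U` has `|φ(x-y)| ≥ ε^(1+θ)`. -/
noncomputable def dualThickNum {E : Type*} [NormedAddCommGroup E] [NormedSpace ℝ E]
    (X : Set E) (θ ε : ℝ) : ℕ∞ :=
  sInf {n : ℕ∞ | ∃ U : Submodule ℝ (E →L[ℝ] ℝ), FiniteDimensional ℝ U ∧ n = Module.finrank ℝ U ∧
    ∀ x ∈ X, ∀ y ∈ X, ε ≤ ‖x - y‖ → ∃ φ ∈ U, ε ^ (1 + θ) ≤ |φ (x - y)|}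

noncomputable def dualThickTheta {E : Type*} [NormedAddCommGroup E] [NormedSpace ℝ E]
    (X : Set E) (θ : ℝ) : EReal :=
  Filter.limsup (fun ε : ℝ => elog (dualThickNum X θ ε) / ((-Real.log ε : ℝ) : EReal)) (𝓝[>] 0)

/-- The dual thickness `τ*(X) = lim_{θ → 0⁺} τ*_θ(X)` (the limit exists by monotonicity and
equals the limsup as `θ → 0⁺`). -/
noncomputable def dualThickness {E : Type*} [NormedAddCommGroup E] [NormedSpace ℝ E]
    (X : Set E) : EReal :=
  Filter.limsup (fun θ : ℝ => dualThickTheta X θ) (𝓝[>] 0)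

/-- `sigmaNum X α ε` : minimal dimension of a subspace `V ⊆ E*` such that whenever
`x, y ∈ X` with `‖x - y‖ ≥ ε` there is `Φ ∈ V` with `‖Φ‖ = 1` and `|Φ(x-y)| ≥ α ε`. -/
noncomputable def sigmaNum {E : Type*} [NormedAddCommGroup E] [NormedSpace ℝ E]
    (X : Set E) (α ε : ℝ) : ℕ∞ :=
  sInf {n : ℕ∞ | ∃ V : Submodule ℝ (E →L[ℝ] ℝ), FiniteDimensional ℝ V ∧ n = Module.finrank ℝ V ∧
    ∀ x ∈ X, ∀ y ∈ X, ε ≤ ‖x - y‖ → ∃ Φ ∈ V, ‖Φ‖ = 1 ∧ α * ε ≤ |Φ (x - y)|}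

noncomputable def sigmaExp {E : Type*} [NormedAddCommGroup E] [NormedSpace ℝ E]
    (X : Set E) (α : ℝ) : EReal :=
  Filter.limsup (fun ε : ℝ => elog (sigmaNum X α ε) / ((-Real.log ε : ℝ) : EReal)) (𝓝[>] 0)

/-- A finite-dimensional normed space has an **Auerbach basis**: unit-ball vectors whose coordinate
functionals are contractive. -/
theorem exists_auerbach_basis (V : Type*) [NormedAddCommGroup V] [NormedSpace ℝ V]
    [FiniteDimensional ℝ V] :
    ∃ b : Module.Basis (Fin (Module.finrank ℝ V)) ℝ V,
      (∀ i, ‖b i‖ ≤ 1) ∧ ∀ i v, |b.coord i v| ≤ ‖v‖ := by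
  set d := Module.finrank ℝ V
  let b₀ : Module.Basis (Fin d) ℝ V := Module.finBasis ℝ V
  let K : Set (Fin d → V) := Set.univ.pi fun _ => closedBall 0 1
  have : ProperSpace V := FiniteDimensional.proper ℝ V
  have hK : IsCompact K := isCompact_univ_pi fun _ => isCompact_closedBall 0 1
  have hcont : Continuous fun e : Fin d → V => |b₀.det e| := by
    simp only [Module.Basis.det_apply]
    refine Continuous.abs ?_
    refine Continuous.matrix_det (continuous_matrix fun i j => ?_)
    exact (LinearMap.continuous_of_finiteDimensional (b₀.coord i)).comp (continuous_apply j)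
  obtain ⟨e, heK, hmax⟩ :=
    hK.exists_isMaxOn ⟨0, by simp [K, Set.mem_pi]⟩ hcont.continuousOn
  have hnorm : ∀ i, ‖e i‖ ≤ 1 := fun i => by simpa using heK i (Set.mem_univ i)
  have hpos : 0 < |b₀.det e| := by
    let u : Fin d → ℝˣ := fun i =>
      Units.mk0 ‖b₀ i‖⁻¹ (inv_ne_zero (norm_ne_zero_iff.2 (b₀.ne_zero i)))
    have hu : (b₀.unitsSMul u : Fin d → V) ∈ K := by
      intro i _
      have : ‖b₀ i‖ ≠ 0 := norm_ne_zero_iff.2 (b₀.ne_zero i)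
      simp [u, Module.Basis.unitsSMul_apply, Units.smul_def, norm_smul, this]
    refine lt_of_lt_of_le ?_ (hmax hu)
    exact abs_pos.2 (b₀.isUnit_det _).ne_zero
  have hunit : IsUnit (b₀.det e) := (abs_pos.1 hpos).isUnit
  obtain ⟨hli, hsp⟩ := b₀.is_basis_iff_det.2 hunit
  refine ⟨Module.Basis.mk hli hsp.ge, fun i => by simpa using hnorm i, fun i v => ?_⟩
  have hunitball : ∀ w : V, ‖w‖ ≤ 1 → |(Module.Basis.mk hli hsp.ge).coord i w| ≤ 1 := by
    intro w hw
    have hmem : Function.update e i w ∈ K := by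
      intro j _
      rcases eq_or_ne j i with rfl | hj
      · simpa using hw
      · simpa [hj] using hnorm j
    have h := congrArg (fun f : V →ₗ[ℝ] ℝ => |f w|)
      (b₀.det_smul_mk_coord_eq_det_update hli hsp.ge i)
    simp only [LinearMap.smul_apply, smul_eq_mul, abs_mul] at h
    have h2 : |b₀.det (Function.update e i w)| ≤ |b₀.det e| := hmax hmem
    have h3 : |b₀.det e| * |(Module.Basis.mk hli hsp.ge).coord i w| ≤ |b₀.det e| := by
      rw [h]; simpa using h2
    exact le_of_mul_le_mul_left (by linarith) hpos
  rcases eq_or_ne v 0 with rfl | hv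
  · rw [map_zero, abs_zero, norm_zero]
  have hv' : 0 < ‖v‖ := norm_pos_iff.2 hv
  have := hunitball (‖v‖⁻¹ • v) (by simp [norm_smul, hv'.ne'])
  rwa [map_smul, smul_eq_mul, abs_mul, abs_inv, abs_norm, inv_mul_le_iff₀ hv', mul_one] at this

/-- Every `d`-dimensional subspace is normed, in the `ℓ¹` sense, by `d` contractive functionals
defined on the whole space. -/
theorem exists_norming_functionals {E : Type*} [NormedAddCommGroup E] [NormedSpace ℝ E]
    (V : Submodule ℝ E) [FiniteDimensional ℝ V] :
    ∃ φ : Fin (Module.finrank ℝ V) → E →L[ℝ] ℝ,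
      (∀ i, ‖φ i‖ ≤ 1) ∧ ∀ v ∈ V, ‖v‖ ≤ ∑ i, |φ i v| := by
  obtain ⟨b, hb, hcoord⟩ := exists_auerbach_basis V
  have hext : ∀ i, ∃ g : E →L[ℝ] ℝ, (∀ v : V, g v = b.coord i v) ∧ ‖g‖ ≤ 1 := by
    intro i
    let f : V →L[ℝ] ℝ := (b.coord i).mkContinuous 1 (by simpa using hcoord i)
    obtain ⟨g, hg, hgn⟩ := exists_extension_norm_eq V f
    exact ⟨g, hg, hgn.trans_le (LinearMap.mkContinuous_norm_le _ zero_le_one _)⟩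
  choose φ hφ hφn using hext
  refine ⟨φ, hφn, fun v hv => ?_⟩
  calc ‖v‖ = ‖(⟨v, hv⟩ : V)‖ := rfl
    _ = ‖∑ i, b.repr ⟨v, hv⟩ i • b i‖ := by rw [b.sum_repr]
    _ ≤ ∑ i, ‖b.repr ⟨v, hv⟩ i • b i‖ := norm_sum_le _ _
    _ ≤ ∑ i, |φ i v| := by
      refine Finset.sum_le_sum fun i _ => ?_
      rw [norm_smul, hφ i ⟨v, hv⟩, Module.Basis.coord_apply, Real.norm_eq_abs]
      exact mul_le_of_le_one_right (abs_nonneg _) (hb i)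

theorem norm_sub_le_sum_add_of_infDist_le {E : Type*} [NormedAddCommGroup E] [NormedSpace ℝ E]
    {V : Submodule ℝ E} {d : ℕ} {φ : Fin d → E →L[ℝ] ℝ} (hφ : ∀ i, ‖φ i‖ ≤ 1)
    (hV : ∀ v ∈ V, ‖v‖ ≤ ∑ i, |φ i v|) {ε : ℝ} (hε : 0 < ε) {x y : E}
    (hx : infDist x (V : Set E) ≤ ε) (hy : infDist y (V : Set E) ≤ ε) :
    ‖x - y‖ ≤ ∑ i, |φ i (x - y)| + 4 * ε * (1 + d) := by
  obtain ⟨v, hv, hxv⟩ := (infDist_lt_iff (V.nonempty)).1 (hx.trans_lt (by linarith : ε < 2 * ε))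
  obtain ⟨w, hw, hyw⟩ := (infDist_lt_iff (V.nonempty)).1 (hy.trans_lt (by linarith : ε < 2 * ε))
  rw [dist_eq_norm] at hxv hyw
  have herr : ‖(x - y) - (v - w)‖ ≤ 4 * ε := by
    rw [sub_sub_sub_comm]
    linarith [norm_sub_le (x - v) (y - w)]
  have hsum : ∑ i, |φ i (v - w)| ≤ ∑ i, |φ i (x - y)| + d * (4 * ε) := by
    have : ∀ i, |φ i (v - w)| ≤ |φ i (x - y)| + 4 * ε := fun i => by
      have h1 : |φ i ((x - y) - (v - w))| ≤ 4 * ε := by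
        refine ((φ i).le_opNorm _).trans (le_trans ?_ herr)
        exact mul_le_of_le_one_left (norm_nonneg _) (hφ i)
      rw [map_sub (φ i) (x - y)] at h1
      rw [abs_le] at h1
      refine abs_le.2 ⟨?_, ?_⟩
      · linarith [neg_abs_le (φ i (x - y))]
      · linarith [le_abs_self (φ i (x - y))]
    calc ∑ i, |φ i (v - w)| ≤ ∑ i, (|φ i (x - y)| + 4 * ε) := Finset.sum_le_sum fun i _ => this i
      _ = _ := by simp [Finset.sum_add_distrib]
  have h := norm_add_le ((x - y) - (v - w)) (v - w)
  rw [sub_add_cancel] at h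
  linarith [hV (v - w) (V.sub_mem hv hw)]

/-- A square-summable countable family of functionals assembles to an operator into `ℓ²`. -/
theorem exists_continuousLinearMap_lp {E : Type*} [NormedAddCommGroup E] [NormedSpace ℝ E]
    {ι : Type*} (f : ι → E →L[ℝ] ℝ) (hf : Summable fun i => ‖f i‖ ^ 2) :
    ∃ Φ : E →L[ℝ] lp (fun _ : ι => ℝ) 2, ∀ x i, Φ x i = f i x := by
  have hle : ∀ x i, ‖f i x‖ ^ 2 ≤ ‖f i‖ ^ 2 * ‖x‖ ^ 2 := fun x i => by
    rw [← mul_pow]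
    gcongr
    exact (f i).le_opNorm x
  have hmem : ∀ x, Memℓp (fun i => f i x) 2 := fun x => by
    refine memℓp_gen ?_
    simpa using Summable.of_nonneg_of_le (fun i => sq_nonneg _) (hle x) (hf.mul_right (‖x‖ ^ 2))
  let T : E →ₗ[ℝ] lp (fun _ : ι => ℝ) 2 :=
    { toFun x := ⟨fun i => f i x, hmem x⟩
      map_add' x y := by ext i; exact map_add (f i) x y
      map_smul' c x := by ext i; exact map_smul (f i) c x }
  refine ⟨T.mkContinuous √(∑' i, ‖f i‖ ^ 2) fun x => ?_, fun x i => rfl⟩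
  refine lp.norm_le_of_forall_sum_le (by simp) (by positivity) fun s => ?_
  have hS : (0 : ℝ) ≤ ∑' i, ‖f i‖ ^ 2 := tsum_nonneg fun i => by positivity
  simp only [ENNReal.toReal_ofNat, Real.rpow_ofNat, mul_pow, Real.sq_sqrt hS]
  calc ∑ i ∈ s, ‖T x i‖ ^ 2 ≤ ∑ i ∈ s, ‖f i‖ ^ 2 * ‖x‖ ^ 2 := Finset.sum_le_sum fun i _ => hle x i
    _ = (∑ i ∈ s, ‖f i‖ ^ 2) * ‖x‖ ^ 2 := by rw [Finset.sum_mul]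
    _ ≤ _ := by
      gcongr
      exact hf.sum_le_tsum s fun i _ => by positivity

theorem separableSpace_lp_two (ι : Type*) [Countable ι] :
    TopologicalSpace.SeparableSpace (lp (fun _ : ι => ℝ) 2) := by
  classical
  let S : Set (lp (fun _ : ι => ℝ) 2) := Set.range fun i => lp.single 2 i (1 : ℝ)
  have hsep : TopologicalSpace.IsSeparable
      (closure (Submodule.span ℝ S : Set (lp (fun _ : ι => ℝ) 2))) :=
    (Set.countable_range _).isSeparable.span.closure
  refine TopologicalSpace.isSeparable_univ_iff.1 (hsep.mono fun x _ => ?_)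
  refine mem_closure_of_tendsto (lp.hasSum_single (by simp) x) (Eventually.of_forall fun s => ?_)
  refine Submodule.sum_mem _ fun i _ => ?_
  have : lp.single 2 i (x i) = x i • (lp.single 2 i (1 : ℝ) : lp (fun _ : ι => ℝ) 2) := by
    rw [← lp.single_smul]; simp
  rw [this]
  exact Submodule.smul_mem _ _ (Submodule.subset_span ⟨i, rfl⟩)

/-- If at every small scale `η` the set `X` lies close to a subspace of dimension at most `η ^ (-p)`,
then some operator into `ℓ²` is bi-Hölder on `X` for every exponent `α > p + 1`. -/
theorem exists_lp_embedding_of_approx {E : Type*} [NormedAddCommGroup E] [NormedSpace ℝ E]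
    {X : Set E} (hX : Bornology.IsBounded X) {p α η₀ : ℝ} (hα : p + 1 < α) (hp : 0 ≤ p)
    (hη₀ : 0 < η₀)
    (happ : ∀ η, 0 < η → η ≤ η₀ → ∃ V : Submodule ℝ E, FiniteDimensional ℝ V ∧
      (Module.finrank ℝ V : ℝ) ≤ η ^ (-p) ∧ ∃ ε, 0 < ε ∧ ε ≤ η ∧
        Module.finrank ℝ V * ε ≤ η ∧ ∀ x ∈ X, infDist x (V : Set E) ≤ ε) :
    ∃ (ι : Type) (_ : Countable ι) (Φ : E →L[ℝ] lp (fun _ : ι => ℝ) 2) (c : ℝ), 0 < c ∧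
      ∀ x ∈ X, ∀ y ∈ X, c * ‖x - y‖ ^ α ≤ ‖Φ x - Φ y‖ := by
  have hscale : ∀ η, 0 < η → η ≤ η₀ → ∃ (d : ℕ) (φ : Fin d → E →L[ℝ] ℝ),
      (d : ℝ) ≤ η ^ (-p) ∧ (∀ i, ‖φ i‖ ≤ 1) ∧
      ∀ x ∈ X, ∀ y ∈ X, 16 * η ≤ ‖x - y‖ → ‖x - y‖ / 2 ≤ ∑ i, |φ i (x - y)| := by
    intro η hη hηle
    obtain ⟨V, hfin, hd, ε, hε, hεη, hdε, hV⟩ := happ η hη hηle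
    obtain ⟨φ, hφ, hφV⟩ := exists_norming_functionals V
    refine ⟨_, φ, hd, hφ, fun x hx y hy hxy => ?_⟩
    have := norm_sub_le_sum_add_of_infDist_le hφ hφV hε (hV x hx) (hV y hy)
    linarith
  let η : ℕ → ℝ := fun n => η₀ * (1 / 2) ^ n
  have hη : ∀ n, 0 < η n := fun n => by positivity
  have hηle : ∀ n, η n ≤ η₀ := fun n =>
    mul_le_of_le_one_right hη₀.le (pow_le_one₀ (by norm_num) (by norm_num))
  choose d φ hd hφ hsep using fun n => hscale (η n) (hη n) (hηle n)
  let f : (Σ n, Fin (d n)) → E →L[ℝ] ℝ := fun k => η k.1 ^ (α - 1 - p / 2) • φ k.1 k.2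
  have hsq : ∀ n, (η n ^ (α - 1 - p / 2)) ^ 2 = η n ^ (2 * (α - 1) - p) := fun n => by
    rw [← Real.rpow_natCast, ← Real.rpow_mul (hη n).le]
    congr 1
    push_cast
    ring
  have hfn : ∀ k, ‖f k‖ ^ 2 ≤ η k.1 ^ (2 * (α - 1) - p) := fun k => by
    have h1 : ‖f k‖ = η k.1 ^ (α - 1 - p / 2) * ‖φ k.1 k.2‖ := by
      simp only [f, norm_smul, Real.norm_eq_abs, abs_of_pos (Real.rpow_pos_of_pos (hη _) _)]
    rw [h1, mul_pow, hsq]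
    refine mul_le_of_le_one_right (Real.rpow_nonneg (hη _).le _) ?_
    exact pow_le_one₀ (norm_nonneg _) (hφ _ _)
  have hsum : Summable fun k => ‖f k‖ ^ 2 := by
    rw [summable_sigma_of_nonneg fun k => by positivity]
    refine ⟨fun n => Summable.of_finite, ?_⟩
    have hgeom : Summable fun n => η n ^ (2 * (α - 1 - p)) := by
      have : ∀ n, η n ^ (2 * (α - 1 - p)) =
          η₀ ^ (2 * (α - 1 - p)) * ((1 / 2 : ℝ) ^ (2 * (α - 1 - p))) ^ n := fun n => by
        simp only [η]
        rw [Real.mul_rpow hη₀.le (by positivity), ← Real.rpow_natCast, ← Real.rpow_mul (by norm_num),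
          ← Real.rpow_natCast, ← Real.rpow_mul (by norm_num), mul_comm (n : ℝ)]
      simp only [this]
      refine (summable_geometric_of_lt_one (by positivity) ?_).mul_left _
      exact Real.rpow_lt_one (by norm_num) (by norm_num) (by linarith)
    refine Summable.of_nonneg_of_le (fun n => tsum_nonneg fun i => by positivity) (fun n => ?_) hgeom
    rw [tsum_fintype]
    calc ∑ i, ‖f ⟨n, i⟩‖ ^ 2 ≤ ∑ _i : Fin (d n), η n ^ (2 * (α - 1) - p) :=
          Finset.sum_le_sum fun i _ => hfn ⟨n, i⟩
      _ = d n * η n ^ (2 * (α - 1) - p) := by simp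
      _ ≤ η n ^ (-p) * η n ^ (2 * (α - 1) - p) :=
          mul_le_mul_of_nonneg_right (hd n) (Real.rpow_nonneg (hη n).le _)
      _ = η n ^ (2 * (α - 1 - p)) := by
          rw [← Real.rpow_add (hη n)]
          ring_nf
  obtain ⟨Φ, hΦ⟩ := exists_continuousLinearMap_lp f hsum
  obtain ⟨D, hDpos, hD⟩ := hX.exists_pos_norm_le
  set K : ℝ := 2 * D + 16 * η₀ with hK
  have hKpos : 0 < K := by positivity
  refine ⟨_, inferInstance, Φ, (η₀ / (2 * K)) ^ (α - 1) / 2, by positivity, fun x hx y hy => ?_⟩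
  rw [← map_sub]
  rcases (norm_nonneg (x - y)).eq_or_lt with h0 | hr
  · rw [← h0, Real.zero_rpow (by linarith), mul_zero]
    exact norm_nonneg _
  have hrK : ‖x - y‖ ≤ K := by linarith [norm_sub_le x y, hD x hx, hD y hy]
  set r := ‖x - y‖ with hrdef
  obtain ⟨m, hm1, hm2⟩ := exists_nat_pow_near_of_lt_one (div_pos hr hKpos)
    ((div_le_one hKpos).2 hrK) (by norm_num : (0 : ℝ) < 1 / 2) (by norm_num)
  have hup : 16 * η (m + 1) ≤ r := by
    have h1 : 16 * η (m + 1) ≤ 16 * η₀ * (r / K) := by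
      simp only [η]
      nlinarith
    refine h1.trans ?_
    rw [mul_div_assoc', div_le_iff₀ hKpos, mul_comm]
    gcongr
    linarith
  have hlow : η₀ / (2 * K) * r ≤ η (m + 1) := by
    have : η₀ / (2 * K) * r = η₀ / 2 * (r / K) := by field_simp
    rw [this]
    simp only [η, pow_succ]
    nlinarith
  generalize m + 1 = n at hup hlow
  have hsum_sq : (r / 2) ^ 2 ≤ η n ^ (-p) * ∑ i, φ n i (x - y) ^ 2 := by
    calc (r / 2) ^ 2 ≤ (∑ i, |φ n i (x - y)|) ^ 2 := by
          gcongr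
          exact hsep n x hx y hy hup
      _ ≤ d n * ∑ i, |φ n i (x - y)| ^ 2 := by
          simpa using sq_sum_le_card_mul_sum_sq (s := Finset.univ) (f := fun i => |φ n i (x - y)|)
      _ ≤ η n ^ (-p) * ∑ i, φ n i (x - y) ^ 2 := by
          simp only [sq_abs]
          exact mul_le_mul_of_nonneg_right (hd n) (Finset.sum_nonneg fun i _ => sq_nonneg _)
  have hnorm_sq : η n ^ (2 * (α - 1) - p) * ∑ i, φ n i (x - y) ^ 2 ≤ ‖Φ (x - y)‖ ^ 2 := by
    have := lp.sum_rpow_le_norm_rpow (by simp) (Φ (x - y))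
      (Finset.univ.map (Function.Embedding.sigmaMk n))
    simp only [ENNReal.toReal_ofNat, Real.rpow_ofNat, Finset.sum_map, hΦ, Real.norm_eq_abs,
      sq_abs] at this
    refine le_trans (le_of_eq ?_) this
    rw [Finset.mul_sum]
    refine Finset.sum_congr rfl fun i _ => ?_
    simp [f, mul_pow, hsq]
  have hkey : (η n ^ (α - 1) * (r / 2)) ^ 2 ≤ ‖Φ (x - y)‖ ^ 2 := by
    have hexp : (η n ^ (α - 1)) ^ 2 * η n ^ (-p) = η n ^ (2 * (α - 1) - p) := by
      rw [← Real.rpow_natCast, ← Real.rpow_mul (hη n).le, ← Real.rpow_add (hη n)]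
      congr 1
      push_cast
      ring
    calc (η n ^ (α - 1) * (r / 2)) ^ 2 = (η n ^ (α - 1)) ^ 2 * (r / 2) ^ 2 := mul_pow _ _ _
      _ ≤ (η n ^ (α - 1)) ^ 2 * (η n ^ (-p) * ∑ i, φ n i (x - y) ^ 2) := by gcongr
      _ = η n ^ (2 * (α - 1) - p) * ∑ i, φ n i (x - y) ^ 2 := by rw [← mul_assoc, hexp]
      _ ≤ _ := hnorm_sq
  refine le_trans ?_ (le_of_sq_le_sq hkey (norm_nonneg _))
  calc (η₀ / (2 * K)) ^ (α - 1) / 2 * r ^ α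
      = (η₀ / (2 * K) * r) ^ (α - 1) * (r / 2) := by
        rw [Real.mul_rpow (by positivity) hr.le, Real.rpow_sub_one hr.ne' α]
        field_simp
    _ ≤ η n ^ (α - 1) * (r / 2) := by
        gcongr
        linarith

theorem elog_nonneg (n : ℕ∞) : 0 ≤ elog n := by
  unfold elog
  split_ifs
  · exact le_top
  · exact_mod_cast Real.log_natCast_nonneg _

theorem thickness_nonneg {E : Type*} [NormedAddCommGroup E] [NormedSpace ℝ E] (X : Set E) :
    0 ≤ thickness X := by
  refine le_limsup_of_frequently_le (Eventually.frequently ?_) (by isBoundedDefault)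
  filter_upwards [Ioo_mem_nhdsGT one_pos] with ε hε
  refine EReal.div_nonneg (elog_nonneg _) ?_
  exact_mod_cast neg_nonneg.2 (Real.log_nonpos hε.1.le hε.2.le)

theorem exists_submodule_of_thickness_lt {E : Type*} [NormedAddCommGroup E] [NormedSpace ℝ E]
    {X : Set E} {s : ℝ} (hs : thickness X < s) :
    ∀ᶠ ε in 𝓝[>] (0 : ℝ), ∃ V : Submodule ℝ E, FiniteDimensional ℝ V ∧
      (Module.finrank ℝ V : ℝ) ≤ ε ^ (-s) ∧ ∀ x ∈ X, infDist x (V : Set E) ≤ ε := by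
  filter_upwards [eventually_lt_of_limsup_lt hs, Ioo_mem_nhdsGT one_pos] with ε hlt hε
  have hlog : 0 < -Real.log ε := neg_pos.2 (Real.log_neg hε.1 hε.2)
  rw [EReal.div_lt_iff (by exact_mod_cast hlog) (EReal.coe_ne_top _)] at hlt
  have htop : thickNum X ε ≠ ⊤ := fun h => by
    simp [elog, h] at hlt
  rw [elog, if_neg htop, ← EReal.coe_mul, EReal.coe_lt_coe_iff] at hlt
  have hne : {n : ℕ∞ | ∃ V : Submodule ℝ E, FiniteDimensional ℝ V ∧ n = Module.finrank ℝ V ∧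
      ∀ x ∈ X, infDist x (V : Set E) ≤ ε}.Nonempty := by
    by_contra h
    exact htop (by rw [thickNum, Set.not_nonempty_iff_eq_empty.1 h, sInf_empty])
  obtain ⟨V, hfin, hV, hdist⟩ := csInf_mem hne
  refine ⟨V, hfin, ?_, hdist⟩
  have hV' : (thickNum X ε).toNat = Module.finrank ℝ V := by
    rw [thickNum, hV, ENat.toNat_natCast]
  rw [hV'] at hlt
  rcases Nat.eq_zero_or_pos (Module.finrank ℝ V) with h0 | hpos
  · rw [h0, Nat.cast_zero]
    exact Real.rpow_nonneg hε.1.le _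
  · rw [Real.rpow_def_of_pos hε.1, ← Real.log_le_iff_le_exp (by exact_mod_cast hpos)]
    linarith

/-- a compact subset of a Banach space with thickness exponent `τ(X) < 1`
embeds linearly into a separable Hilbert space with `α⁻¹`-Hölder inverse for every
`α > (1 + τ(X))/(1 - τ(X))`. -/
theorem exists_hilbert_embedding_of_thickness {B : Type*}
    [NormedAddCommGroup B] [NormedSpace ℝ B] [CompleteSpace B]
    (X : Set B) (hX : IsCompact X) (hτ : thickness X < (1 : EReal))
    (α : ℝ) (hα : (1 + thickness X) / (1 - thickness X) < (α : EReal)) :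
    ∃ (H : Type) (_ : NormedAddCommGroup H) (_ : InnerProductSpace ℝ H),
      CompleteSpace H ∧ TopologicalSpace.SeparableSpace H ∧
      ∃ (Φ : B →L[ℝ] H) (C : ℝ), 0 < C ∧
        ∀ x ∈ X, ∀ y ∈ X,
          C⁻¹ * ‖x - y‖ ^ α ≤ ‖Φ x - Φ y‖ ∧ ‖Φ x - Φ y‖ ≤ C * ‖x - y‖ := by
  obtain ⟨t, ht⟩ : ∃ t : ℝ, thickness X = t := by
    have hbot : thickness X ≠ ⊥ := ((EReal.bot_lt_zero).trans_le (thickness_nonneg X)).ne'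
    exact ⟨_, (EReal.coe_toReal (hτ.trans (EReal.coe_lt_top 1)).ne hbot).symm⟩
  have ht0 : 0 ≤ t := by
    have := thickness_nonneg X
    rw [ht] at this
    exact_mod_cast this
  have ht1 : t < 1 := by
    rw [ht] at hτ
    exact_mod_cast hτ
  have hαt : (1 + t) / (1 - t) < α := by
    rw [ht] at hα
    have h : (((1 + t) / (1 - t) : ℝ) : EReal) < α := by
      rw [EReal.coe_div]
      exact_mod_cast hα
    exact_mod_cast h
  obtain ⟨s, hts, hs1, hsα⟩ : ∃ s, t < s ∧ s < 1 ∧ s / (1 - s) + 1 < α := by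
    have hcont : ContinuousAt (fun s : ℝ => s / (1 - s) + 1) t :=
      (continuousAt_id.div (by fun_prop) (sub_pos.2 ht1).ne').add continuousAt_const
    have hlt : t / (1 - t) + 1 < α := by
      refine lt_of_le_of_lt ?_ hαt
      rw [div_add_one (sub_pos.2 ht1).ne']
      exact div_le_div_of_nonneg_right (by linarith) (sub_pos.2 ht1).le
    have hev := (hcont.eventually (gt_mem_nhds hlt)).filter_mono
      (nhdsWithin_le_nhds (s := Set.Ioi t))
    obtain ⟨s, h1, h2⟩ := (hev.and (Ioo_mem_nhdsGT ht1)).exists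
    exact ⟨s, h2.1, h2.2, h1⟩
  have h1s : 0 < 1 - s := by linarith
  have hs0 : 0 < s := by linarith
  have hev := exists_submodule_of_thickness_lt (X := X) (s := s) (by rw [ht]; exact_mod_cast hts)
  obtain ⟨δ, hδ, hδV⟩ := (mem_nhdsGT_iff_exists_Ioo_subset).1 hev
  have hδ' : (0 : ℝ) < δ := hδ
  obtain ⟨ι, hι, Φ, c, hc, hΦ⟩ := exists_lp_embedding_of_approx hX.isBounded hsα (by positivity)
    (η₀ := min 1 ((δ / 2) ^ (1 - s))) (by positivity) (fun η hη hηle => by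
      have hη1 : η ≤ 1 := hηle.trans (min_le_left _ _)
      set ε := η ^ (1 - s)⁻¹ with hεdef
      have hε : 0 < ε := by positivity
      have hεδ : ε < δ := by
        have : ε ≤ δ / 2 := by
          rw [hεdef, Real.rpow_inv_le_iff_of_pos hη.le (by positivity) h1s]
          exact hηle.trans (min_le_right _ _)
        linarith
      have hpow : ε ^ (-s) = η ^ (-(s / (1 - s))) := by
        rw [hεdef, ← Real.rpow_mul hη.le]
        congr 1
        field_simp
      have hpow' : ε ^ (-s) * ε = η := by
        rw [← Real.rpow_add_one hε.ne', hεdef, ← Real.rpow_mul hη.le]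
        convert Real.rpow_one η using 2
        field_simp
        ring
      obtain ⟨V, hfin, hd, hV⟩ := hδV ⟨hε, hεδ⟩
      refine ⟨V, hfin, hd.trans_eq hpow, ε, hε, ?_, ?_, hV⟩
      · calc ε ≤ η ^ (1 : ℝ) :=
            Real.rpow_le_rpow_of_exponent_ge hη hη1 (one_le_inv_iff₀.2 ⟨h1s, by linarith⟩)
          _ = η := Real.rpow_one η
      · calc Module.finrank ℝ V * ε ≤ ε ^ (-s) * ε := by gcongr
          _ = η := hpow')
  refine ⟨lp (fun _ : ι => ℝ) 2, inferInstance, inferInstance, inferInstance,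
    separableSpace_lp_two ι, Φ, max c⁻¹ ‖Φ‖, lt_max_of_lt_left (inv_pos.2 hc),
    fun x hx y hy => ⟨?_, ?_⟩⟩
  · refine le_trans ?_ (hΦ x hx y hy)
    gcongr
    exact inv_le_of_inv_le₀ hc (le_max_left _ _)
  · rw [← map_sub]
    refine (Φ.le_opNorm _).trans ?_
    gcongr
    exact le_max_right _ _
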